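/- arXiv:1404.6648 — 4 statements merged into one kernel-verified Lean document; each statement's English description precedes it below -/
import Mathlib

section
/- Let $a > 0$ and $0 < b < d$ be real numbers, and consider the rates $b_i = b\, i^a$ and $d_i = d\, i^a$ for $i \ge 1$. Let $\phi : \mathbb{N} \to \mathbb{R}$ be defined by $\phi(0) = 0$ and $\phi(i) = (\sqrt{d/b})^{\,i}$ for $i \ge 1$. Then for every $i \ge 2$, $\mathcal{L}\phi(i) = -i^a\, (\sqrt{d} - \sqrt{b})^2\, (\sqrt{d/b})^{\,i}$, and moreover $\mathcal{L}\phi(1) \le -(\sqrt{d} - \sqrt{b})^2\, (\sqrt{d/b})$. -/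
/-- Example 1, computation: for rates `b_i = b i^a`, `d_i = d i^a` with
`0 < b < d`, `a > 0`, and `φ(i) = √(d/b)^i` (with `φ(0) = 0`), one has
`L φ(i) = -i^a (√d - √b)^2 √(d/b)^i` for `i ≥ 2`, and
`L φ(1) ≤ -(√d - √b)^2 √(d/b)`. -/
theorem linear_like_rates_generator_computation
    (a bc dc : ℝ) (ha : 0 < a) (hbc : 0 < bc) (hbd : bc < dc)
    (b d : ℕ → ℝ)
    (hb0 : b 0 = 0) (hd0 : d 0 = 0)
    (hbR : ∀ i : ℕ, 1 ≤ i → b i = bc * (i : ℝ) ^ a)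
    (hdR : ∀ i : ℕ, 1 ≤ i → d i = dc * (i : ℝ) ^ a)
    (φ : ℕ → ℝ)
    (hφ0 : φ 0 = 0)
    (hφ : ∀ i : ℕ, 1 ≤ i → φ i = Real.sqrt (dc / bc) ^ i) :
    (∀ i : ℕ, 2 ≤ i →
      b i * (φ (i + 1) - φ i) + d i * (φ (i - 1) - φ i)
        = -(i : ℝ) ^ a * (Real.sqrt dc - Real.sqrt bc) ^ 2 * Real.sqrt (dc / bc) ^ i) ∧
    b 1 * (φ 2 - φ 1) + d 1 * (φ 0 - φ 1)
      ≤ -(Real.sqrt dc - Real.sqrt bc) ^ 2 * Real.sqrt (dc / bc) := by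
  have hdc : 0 < dc := hbc.trans hbd
  have ht : Real.sqrt dc = Real.sqrt (dc / bc) * Real.sqrt bc := by
    rw [← Real.sqrt_mul (by positivity), div_mul_cancel₀ _ hbc.ne']
  have hs2 : bc = Real.sqrt bc ^ 2 := (Real.sq_sqrt hbc.le).symm
  have ht2 : dc = (Real.sqrt (dc / bc) * Real.sqrt bc) ^ 2 := by
    rw [← ht, Real.sq_sqrt hdc.le]
  rw [ht]
  generalize Real.sqrt (dc / bc) = r at *
  generalize Real.sqrt bc = s at *
  constructor
  · intro i hi
    obtain ⟨k, rfl⟩ : ∃ k, i = k + 1 := ⟨i - 1, by omega⟩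
    rw [hbR _ (by omega), hdR _ (by omega), hφ _ (by omega), hφ _ (by omega),
      hφ _ (by omega), Nat.add_sub_cancel, hs2, ht2]
    ring
  · rw [hbR 1 le_rfl, hdR 1 le_rfl, hφ 1 le_rfl, hφ 2 (by omega), hφ0, hs2, ht2]
    simp only [Nat.cast_one, Real.one_rpow]
    nlinarith [sq_nonneg (r * s)]
end

section
/- Let $a > 0$ and $0 < b < d$ be real numbers, and consider the rates $b_i = b\, i^a$ and $d_i = d\, i^a$ for $i \ge 1$. Let $\phi : \mathbb{N} \to \mathbb{R}$ be defined by $\phi(0) = 0$ and $\phi(i) = (\sqrt{d/b})^{\,i}$ for $i \ge 1$. Then there exist a constant $C > 0$ and a real number $\lambda_1 > d_1 = d$ such that $\mathcal{L}\phi(i) \le -\lambda_1 \phi(i) + C$ for every $i \ge 1$. -/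
/-- Example 1, Lyapunov criterion: for rates `b_i = b i^a`, `d_i = d i^a` with
`0 < b < d`, `a > 0`, the function `φ(i) = √(d/b)^i` (with `φ(0) = 0`) satisfies
`L φ ≤ -λ₁ φ + C` for some constants `C > 0` and `λ₁ > d₁ = d`. -/
theorem linear_like_rates_lyapunov
    (a bc dc : ℝ) (ha : 0 < a) (hbc : 0 < bc) (hbd : bc < dc)
    (b d : ℕ → ℝ)
    (hb0 : b 0 = 0) (hd0 : d 0 = 0)
    (hbR : ∀ i : ℕ, 1 ≤ i → b i = bc * (i : ℝ) ^ a)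
    (hdR : ∀ i : ℕ, 1 ≤ i → d i = dc * (i : ℝ) ^ a)
    (φ : ℕ → ℝ)
    (hφ0 : φ 0 = 0)
    (hφ : ∀ i : ℕ, 1 ≤ i → φ i = Real.sqrt (dc / bc) ^ i) :
    ∃ C : ℝ, 0 < C ∧ ∃ lam1 : ℝ, dc < lam1 ∧
      ∀ i : ℕ, 1 ≤ i →
        b i * (φ (i + 1) - φ i) + d i * (φ (i - 1) - φ i) ≤ -lam1 * φ i + C := by
  set s := Real.sqrt (dc / bc) with hs
  have hs1 : 1 < s := by
    rw [hs, Real.lt_sqrt (by norm_num), lt_div_iff₀ hbc]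
    linarith
  have hs2 : dc = bc * s ^ 2 := by
    rw [hs, Real.sq_sqrt (div_nonneg (by linarith) hbc.le)]
    field_simp
  have hk : 0 < bc * (s - 1) ^ 2 := mul_pos hbc (pow_pos (by linarith) 2)
  have hev : ∀ᶠ i : ℕ in Filter.atTop, (dc + 1) / (bc * (s - 1) ^ 2) ≤ (i : ℝ) ^ a :=
    ((tendsto_rpow_atTop ha).comp tendsto_natCast_atTop_atTop).eventually_ge_atTop _
  obtain ⟨N, hN⟩ := Filter.eventually_atTop.1 hev
  have hd : 0 < dc := by linarith
  have hC : 0 < (dc + 1) * s ^ N + 1 := by positivity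
  refine ⟨(dc + 1) * s ^ N + 1, hC, dc + 1, by linarith, fun i hi => ?_⟩
  have hφle : ∀ j, φ j ≤ s ^ j := by
    intro j
    rcases Nat.eq_zero_or_pos j with h | h
    · subst h; simp [hφ0]
    · exact (hφ j h).le
  obtain ⟨j, rfl⟩ : ∃ j, i = j + 1 := ⟨i - 1, by omega⟩
  have hx : 0 < ((j + 1 : ℕ) : ℝ) ^ a := Real.rpow_pos_of_pos (by positivity) a
  rw [hbR _ hi, hdR _ hi, hφ _ hi, hφ (j + 1 + 1) (by omega), Nat.add_sub_cancel]
  have hNj := hN (j + 1)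
  set x := ((j + 1 : ℕ) : ℝ) ^ a
  have h1 : dc * x * (φ j - s ^ (j + 1)) ≤ dc * x * (s ^ j - s ^ (j + 1)) :=
    mul_le_mul_of_nonneg_left (by linarith [hφle j]) (by positivity)
  have h2 : bc * x * (s ^ (j + 1 + 1) - s ^ (j + 1)) + dc * x * (s ^ j - s ^ (j + 1))
      = -(x * (bc * (s - 1) ^ 2)) * s ^ (j + 1) := by
    rw [hs2]; ring
  have hsp : 0 < s ^ (j + 1) := by positivity
  rcases le_total N (j + 1) with h | h
  · have h3 := hNj h
    rw [div_le_iff₀ hk] at h3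
    have h4 := mul_le_mul_of_nonneg_right h3 hsp.le
    linarith
  · have h3 : (dc + 1) * s ^ (j + 1) ≤ (dc + 1) * s ^ N :=
      mul_le_mul_of_nonneg_left (pow_le_pow_right₀ hs1.le h) (by linarith)
    have h4 : 0 < x * (bc * (s - 1) ^ 2) * s ^ (j + 1) := by positivity
    linarith
end

section
/- Let $0 < b < d$ be real numbers, let $b_1 > 0$ be arbitrary, and let $d_1 > 0$ satisfy $(\sqrt{d} - \sqrt{b})^2 > d_1$; consider the rates $b_i = b$ and $d_i = d$ for all $i \ge 2$. Let $\phi : \mathbb{N} \to \mathbb{R}$ be defined by $\phi(0) = 0$ and $\phi(i) = (\sqrt{d/b})^{\,i}$ for $i \ge 1$. Then there exist a constant $C > 0$ and a real number $\lambda_1 > d_1$ such that $\mathcal{L}\phi(i) \le -\lambda_1 \phi(i) + C$ for every $i \ge 1$. -/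
/-- Example 2, Lyapunov criterion: for rates `b_i = b`, `d_i = d` for `i ≥ 2`
(`0 < b < d`), arbitrary `b₁ > 0` and `d₁ > 0` with `(√d - √b)^2 > d₁`, the function
`φ(i) = √(d/b)^i` (with `φ(0) = 0`) satisfies `L φ ≤ -λ₁ φ + C` for some constants
`C > 0` and `λ₁ > d₁`. -/
theorem constant_rates_lyapunov
    (bc dc : ℝ) (hbc : 0 < bc) (hbd : bc < dc)
    (b d : ℕ → ℝ)
    (hb0 : b 0 = 0) (hd0 : d 0 = 0)
    (hb1 : 0 < b 1) (hd1 : 0 < d 1)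
    (hd1' : d 1 < (Real.sqrt dc - Real.sqrt bc) ^ 2)
    (hbR : ∀ i : ℕ, 2 ≤ i → b i = bc)
    (hdR : ∀ i : ℕ, 2 ≤ i → d i = dc)
    (φ : ℕ → ℝ)
    (hφ0 : φ 0 = 0)
    (hφ : ∀ i : ℕ, 1 ≤ i → φ i = Real.sqrt (dc / bc) ^ i) :
    ∃ C : ℝ, 0 < C ∧ ∃ lam1 : ℝ, d 1 < lam1 ∧
      ∀ i : ℕ, 1 ≤ i →
        b i * (φ (i + 1) - φ i) + d i * (φ (i - 1) - φ i) ≤ -lam1 * φ i + C := by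
  refine ⟨|b 1 * (φ 2 - φ 1) + d 1 * (φ 0 - φ 1) + (Real.sqrt dc - Real.sqrt bc) ^ 2 * φ 1| + 1,
    by positivity, (Real.sqrt dc - Real.sqrt bc) ^ 2, hd1', ?_⟩
  intro i hi
  obtain rfl | hi2 : i = 1 ∨ 2 ≤ i := by omega
  · have := le_abs_self
      (b 1 * (φ 2 - φ 1) + d 1 * (φ 0 - φ 1) + (Real.sqrt dc - Real.sqrt bc) ^ 2 * φ 1)
    norm_num at this ⊢
    linarith
  · obtain ⟨k, rfl⟩ : ∃ k, i = k + 2 := ⟨i - 2, by omega⟩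
    have e : k + 2 - 1 = k + 1 := by omega
    rw [hbR _ hi2, hdR _ hi2, e, hφ (k + 2 + 1) (by omega), hφ (k + 2) (by omega),
      hφ (k + 1) (by omega)]
    have hs : 0 < Real.sqrt bc := Real.sqrt_pos.mpr hbc
    have hs2 : bc = Real.sqrt bc ^ 2 := (Real.sq_sqrt hbc.le).symm
    have ht2 : dc = Real.sqrt dc ^ 2 := (Real.sq_sqrt (hbc.trans hbd).le).symm
    have hr : Real.sqrt dc = Real.sqrt (dc / bc) * Real.sqrt bc := by
      rw [Real.sqrt_div (hbc.trans hbd).le]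
      field_simp
    have key : bc * (Real.sqrt (dc / bc) ^ (k + 2 + 1) - Real.sqrt (dc / bc) ^ (k + 2))
        + dc * (Real.sqrt (dc / bc) ^ (k + 1) - Real.sqrt (dc / bc) ^ (k + 2))
        = -(Real.sqrt dc - Real.sqrt bc) ^ 2 * Real.sqrt (dc / bc) ^ (k + 2) := by
      generalize Real.sqrt (dc / bc) = r at *
      generalize Real.sqrt dc = t at *
      generalize Real.sqrt bc = s at *
      subst hs2 ht2 hr
      ring
    rw [key]
    have := abs_nonneg
      (b 1 * (φ 2 - φ 1) + d 1 * (φ 0 - φ 1) + (Real.sqrt dc - Real.sqrt bc) ^ 2 * φ 1)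
    linarith
end

section
/- Let $0 < d_1 < \lambda_1$ and $C \ge 0$ be real constants, and let $u, v : [0, \infty) \to \mathbb{R}$ be differentiable functions with $u(t) \ge 0$ and $v(t) > 0$ for all $t \ge 0$, satisfying $u'(t) \le -\lambda_1 u(t) + C\, v(t)$ and $v'(t) \ge -d_1 v(t)$ for all $t \ge 0$. Then for every $t \ge 0$, $\frac{u(t)}{v(t)} \le \max\Big( \frac{u(0)}{v(0)},\ \frac{C}{\lambda_1 - d_1} \Big)$. -/
/-- Gronwall-type argument: if `u ≥ 0`, `v > 0` are differentiable on
`[0,∞)` with `u' ≤ -λ₁ u + C v` and `v' ≥ -d₁ v` there, and `0 < d₁ < λ₁`, `C ≥ 0`, then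
`u(t)/v(t) ≤ max (u(0)/v(0)) (C/(λ₁ - d₁))` for all `t ≥ 0`. -/
theorem gronwall_ratio_bound
    (d1 lam1 C : ℝ) (hd1 : 0 < d1) (hlam1 : d1 < lam1) (hC : 0 ≤ C)
    (u v u' v' : ℝ → ℝ)
    (hu : ∀ t : ℝ, 0 ≤ t → HasDerivAt u (u' t) t)
    (hv : ∀ t : ℝ, 0 ≤ t → HasDerivAt v (v' t) t)
    (hunonneg : ∀ t : ℝ, 0 ≤ t → 0 ≤ u t)
    (hvpos : ∀ t : ℝ, 0 ≤ t → 0 < v t)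
    (hu' : ∀ t : ℝ, 0 ≤ t → u' t ≤ -lam1 * u t + C * v t)
    (hv' : ∀ t : ℝ, 0 ≤ t → -d1 * v t ≤ v' t) :
    ∀ t : ℝ, 0 ≤ t → u t / v t ≤ max (u 0 / v 0) (C / (lam1 - d1)) := by
  intro t ht
  set M := max (u 0 / v 0) (C / (lam1 - d1)) with hM
  have hpos : 0 < lam1 - d1 := by linarith
  have hM1 : u 0 / v 0 ≤ M := le_max_left _ _
  have hM2 : C / (lam1 - d1) ≤ M := le_max_right _ _
  have hM0 : 0 ≤ M := le_trans (div_nonneg hC hpos.le) hM2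
  rw [div_le_iff₀ hpos] at hM2
  rw [div_le_iff₀ (hvpos 0 le_rfl)] at hM1
  rw [div_le_iff₀ (hvpos t ht)]
  have hder : ∀ s : ℝ, 0 ≤ s → HasDerivAt (fun x => Real.exp (lam1 * x) * (u x - M * v x))
      (Real.exp (lam1 * s) * (lam1 * 1) * (u s - M * v s)
        + Real.exp (lam1 * s) * (u' s - M * v' s)) s := by
    intro s hs
    exact (((hasDerivAt_id s).const_mul lam1).exp).mul ((hu s hs).sub ((hv s hs).const_mul M))
  have hanti : AntitoneOn (fun x => Real.exp (lam1 * x) * (u x - M * v x)) (Set.Ici 0) := by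
    apply antitoneOn_of_deriv_nonpos (convex_Ici 0)
    · intro s hs
      exact (hder s hs).continuousAt.continuousWithinAt
    · intro s hs
      rw [interior_Ici] at hs
      exact (hder s (le_of_lt hs)).differentiableAt.differentiableWithinAt
    · intro s hs
      rw [interior_Ici] at hs
      have hs0 : 0 ≤ s := le_of_lt hs
      rw [(hder s hs0).deriv]
      have h1 := hu' s hs0
      have h2 := mul_le_mul_of_nonneg_left (hv' s hs0) hM0
      have h3 := mul_le_mul_of_nonneg_right hM2 (hvpos s hs0).le
      have h4 : lam1 * (u s - M * v s) + (u' s - M * v' s) ≤ 0 := by nlinarith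
      have h5 := mul_nonpos_of_nonneg_of_nonpos (Real.exp_pos (lam1 * s)).le h4
      linarith
  have h := hanti (Set.mem_Ici.2 le_rfl) (Set.mem_Ici.2 ht) ht
  simp only [mul_zero, Real.exp_zero, one_mul] at h
  have h6 : Real.exp (lam1 * t) * (u t - M * v t) ≤ 0 := by linarith
  have h7 := nonpos_of_mul_nonpos_right h6 (Real.exp_pos _)
  linarith
end
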